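/- Let ρ ∈ [0, 1), c > 0 and T > 0. Then there exist constants C > 0 and μ₀ ∈ (0, 1) such that for every μ ∈ (0, μ₀], every B ≥ 1, every ε ∈ [0, 1], and all sequences (a_n)_{n≥0}, (b_n)_{n≥0} of nonnegative reals satisfying a₀ ≤ c(μ/B + ε^{7/4}), b₀ ≤ c(μ/B + ε^{7/4}), and for all n ≥ 1: a_n ≤ ((1 + cμ)/(1 − cμ)) a_{n−1} + cμ b_{n−1} + cμ²/B + cμε², and b_n ≤ (ρ + cμ²) b_{n−1} + cμ² a_{n−1} + cμ², one has a_n + b_n ≤ C(μ/B + μ² + ε^{7/4}) for every integer n with 0 ≤ n ≤ T/μ. -/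

import Mathlib

/-- On `[0, 1/2]` the amplification factor `(1 + x) / (1 - x)` is at most `1 + 4 * x`. -/
lemma one_add_div_one_sub_le {x : ℝ} (hx0 : 0 ≤ x) (hx : x ≤ 1 / 2) :
    (1 + x) / (1 - x) ≤ 1 + 4 * x := by
  rw [div_le_iff₀ (by linarith)]
  nlinarith

/-- A sequence `a` with growth factor `1 + 4 * x`, driven by a contracting sequence `b` whose own
forcing is controlled by `S`: both are dominated by a geometric sequence of ratio
`1 + (5 + D) * x`. -/
lemma coupled_geometric_bound {ρ c D x y A S : ℝ} {a b : ℕ → ℝ} (hρ : 0 ≤ ρ) (hc : 0 ≤ c)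
    (hD : 0 ≤ D) (hx : 0 ≤ x) (hy : 0 ≤ y) (hA : 1 ≤ A) (hS : 0 ≤ S)
    (hcontr : (ρ + y) * D + y + c ≤ D)
    (ha0 : a 0 ≤ A * S) (hb0 : b 0 ≤ D * (A * S))
    (ha : ∀ n, a (n + 1) ≤ (1 + 4 * x) * a n + x * b n + x * S)
    (hb : ∀ n, b (n + 1) ≤ (ρ + y) * b n + y * a n + c * S) (n : ℕ) :
    a n ≤ (1 + (5 + D) * x) ^ n * (A * S) ∧ b n ≤ D * ((1 + (5 + D) * x) ^ n * (A * S)) := by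
  induction n with
  | zero => simpa using ⟨ha0, hb0⟩
  | succ n ih =>
    obtain ⟨iha, ihb⟩ := ih
    have hratio : 0 ≤ (5 + D) * x := by positivity
    have hSX : S ≤ (1 + (5 + D) * x) ^ n * (A * S) := by
      have h1 : 1 ≤ (1 + (5 + D) * x) ^ n := one_le_pow₀ (by linarith)
      nlinarith [mul_le_mul h1 hA zero_le_one (by linarith)]
    rw [pow_succ', mul_assoc]
    set X := (1 + (5 + D) * x) ^ n * (A * S)
    have hX : 0 ≤ X := hS.trans hSX
    constructor
    · calc a (n + 1) ≤ (1 + 4 * x) * a n + x * b n + x * S := ha n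
        _ ≤ (1 + 4 * x) * X + x * (D * X) + x * X := by gcongr
        _ = (1 + (5 + D) * x) * X := by ring
    · calc b (n + 1) ≤ (ρ + y) * b n + y * a n + c * S := hb n
        _ ≤ (ρ + y) * (D * X) + y * X + c * X := by gcongr
        _ = ((ρ + y) * D + y + c) * X := by ring
        _ ≤ D * X := by gcongr
        _ ≤ D * ((1 + (5 + D) * x) * X) := by
          gcongr
          nlinarith [mul_nonneg hratio hX]


/-- Coupled-recursion comparison underlying Lemma 3 (second-order moment bounds
of decentralized adversarial training): over a horizon `n ≤ T/μ`, the coupled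
sequences satisfy `a_n + b_n ≤ C(μ/B + μ² + ε^{7/4})`. -/
theorem second_moment_recursion_bound
    (ρ : ℝ) (hρ0 : 0 ≤ ρ) (hρ1 : ρ < 1) (c T : ℝ) (hc : 0 < c) (hT : 0 < T) :
    ∃ C > 0, ∃ μ₀ : ℝ, 0 < μ₀ ∧ μ₀ < 1 ∧
      ∀ μ : ℝ, 0 < μ → μ ≤ μ₀ →
      ∀ B : ℝ, 1 ≤ B →
      ∀ ε : ℝ, 0 ≤ ε → ε ≤ 1 →
      ∀ a b : ℕ → ℝ, (∀ n, 0 ≤ a n) → (∀ n, 0 ≤ b n) →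
      a 0 ≤ c * (μ / B + ε ^ ((7 : ℝ) / 4)) →
      b 0 ≤ c * (μ / B + ε ^ ((7 : ℝ) / 4)) →
      (∀ n : ℕ, a (n + 1) ≤ ((1 + c * μ) / (1 - c * μ)) * a n + c * μ * b n
          + c * μ ^ 2 / B + c * μ * ε ^ 2) →
      (∀ n : ℕ, b (n + 1) ≤ (ρ + c * μ ^ 2) * b n + c * μ ^ 2 * a n + c * μ ^ 2) →
      ∀ n : ℕ, (n : ℝ) ≤ T / μ →
        a n + b n ≤ C * (μ / B + μ ^ 2 + ε ^ ((7 : ℝ) / 4)) := by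
  have hgap : 0 < 1 - ρ := by linarith
  set D : ℝ := 4 * c / (1 - ρ) with hDdef
  have hD : 0 < D := by positivity
  have hDmul : D * (1 - ρ) = 4 * c := by rw [hDdef]; field_simp
  have hcD : c ≤ D := by nlinarith
  have hμ₀lt : (1 - ρ) / (2 * (1 + c)) < 1 := by
    rw [div_lt_one (by positivity)]
    linarith
  refine ⟨(1 + D) * (Real.exp ((5 + D) * (c * T)) * (1 + c)), by positivity,
    (1 - ρ) / (2 * (1 + c)), by positivity, hμ₀lt, ?_⟩
  intro μ hμ hμle B hB ε hε0 hε1 a b han hbn ha0 hb0 ha hb n hn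
  have hμ1 : μ ≤ 1 := hμle.trans hμ₀lt.le
  have hcμ : c * μ ≤ (1 - ρ) / 2 := by
    rw [le_div_iff₀ (by positivity)] at hμle
    nlinarith
  have hcμ2 : c * μ ^ 2 ≤ c * μ := by nlinarith [mul_pos hc hμ]
  have hcμ2c : c * μ ^ 2 ≤ c := by nlinarith
  have hε : ε ^ 2 ≤ ε ^ ((7 : ℝ) / 4) := by
    rw [← Real.rpow_natCast]
    exact Real.rpow_le_rpow_of_exponent_ge_of_imp hε0 hε1 (by norm_num) (by norm_num)
  have hε' : 0 ≤ ε ^ ((7 : ℝ) / 4) := Real.rpow_nonneg hε0 _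
  have hμB : 0 ≤ μ / B := by positivity
  have hμ2 : 0 ≤ μ ^ 2 := sq_nonneg μ
  set S := μ / B + μ ^ 2 + ε ^ ((7 : ℝ) / 4) with hSdef
  have hS : 0 ≤ S := by positivity
  have hinit : c * (μ / B + ε ^ ((7 : ℝ) / 4)) ≤ c * S := by
    gcongr
    linarith
  have hcoupled := coupled_geometric_bound (a := a) (b := b) (x := c * μ) (y := c * μ ^ 2)
    (A := 1 + c) (S := S) hρ0 hc.le hD.le (by positivity) (by positivity) (by linarith) hS
    (by nlinarith)
    (by linarith)
    (by nlinarith [mul_le_mul_of_nonneg_right hcD hS, mul_nonneg hD.le (mul_nonneg hc.le hS)])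
    (fun k => by
      have hforce : c * μ ^ 2 / B + c * μ * ε ^ 2 ≤ c * μ * S := by
        calc c * μ ^ 2 / B + c * μ * ε ^ 2 = c * μ * (μ / B + ε ^ 2) := by ring
          _ ≤ c * μ * S := by
            gcongr
            linarith
      have hgrow := mul_le_mul_of_nonneg_right
        (one_add_div_one_sub_le (mul_pos hc hμ).le (by linarith)) (han k)
      linarith [ha k])
    (fun k => by
      have : c * μ ^ 2 ≤ c * S := by
        gcongr
        linarith
      linarith [hb k]) n
  have hexp : (1 + (5 + D) * (c * μ)) ^ n ≤ Real.exp ((5 + D) * (c * T)) := by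
    rw [le_div_iff₀ hμ] at hn
    calc (1 + (5 + D) * (c * μ)) ^ n ≤ Real.exp ((5 + D) * (c * μ)) ^ n := by
          gcongr
          linarith [Real.add_one_le_exp ((5 + D) * (c * μ))]
      _ = Real.exp ((5 + D) * (c * (n * μ))) := by
          rw [← Real.exp_nat_mul]
          ring_nf
      _ ≤ Real.exp ((5 + D) * (c * T)) := by gcongr
  calc a n + b n ≤ (1 + D) * ((1 + (5 + D) * (c * μ)) ^ n * ((1 + c) * S)) := by
        linarith [hcoupled.1, hcoupled.2]
    _ ≤ (1 + D) * (Real.exp ((5 + D) * (c * T)) * ((1 + c) * S)) := by gcongr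
    _ = (1 + D) * (Real.exp ((5 + D) * (c * T)) * (1 + c)) * S := by ring
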